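/- arXiv:2408.15012 — 11 statements merged into one kernel-verified Lean document; each statement's English description precedes it below -/
import Mathlib

section
/- Let X be a finite set and let m₁, m₂ be mass functions on X with m₁ ≤_↑ m₂ (the upward restricted order). Then for any formal context (A, X, I) and any G ⊆ A, ρ_{m₁}(G) ≤ ρ_{m₂}(G). -/
open scoped Classical

noncomputable section

/-- In a formal context `(A, X, I)` (with `I ⊆ A × X`), a set `B ⊆ A` is a `Y`-extent
(for `Y ⊆ X`) if `B = {a | ∀ x ∈ Y', (a, x) ∈ I}` for some `Y' ⊆ Y`. -/
def IsExtent {A X : Type*} (I : Set (A × X)) (Y : Set X) (B : Set A) : Prop :=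
  ∃ Y' ⊆ Y, B = {a : A | ∀ x ∈ Y', (a, x) ∈ I}

/-- A (Dempster-Shafer) mass function on a finite set `X`:
a map `𝒫(X) → [0,1]` whose values sum to `1`. -/
def IsMass {X : Type*} [Fintype X] (m : Finset X → ℝ) : Prop :=
  (∀ Y : Finset X, 0 ≤ m Y ∧ m Y ≤ 1) ∧ ∑ Y : Finset X, m Y = 1

/-- The stability index `ρ_m(G) = Σ_{Y ⊆ X, G is a Y-extent} m(Y)`. -/
def stabilityIndex {A X : Type*} [Fintype X] (I : Set (A × X)) (m : Finset X → ℝ)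
    (G : Set A) : ℝ :=
  ∑ Y : Finset X, if IsExtent I (Y : Set X) G then m Y else 0

/-- `𝒞(m, β)`: the sets `G ⊆ A` which are `Y`-extents for some `Y ⊆ X` and
whose stability index is at least `β`. -/
def Csys {A X : Type*} [Fintype X] (I : Set (A × X)) (m : Finset X → ℝ) (β : ℝ) :
    Set (Set A) :=
  {G | (∃ Y : Set X, IsExtent I Y G) ∧ β ≤ stabilityIndex I m G}

/-- `𝕃(m, β)`: all intersections of (possibly empty) subfamilies of `𝒞(m, β)`. -/
def Lsys {A X : Type*} [Fintype X] (I : Set (A × X)) (m : Finset X → ℝ) (β : ℝ) :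
    Set (Set A) :=
  {L | ∃ 𝒢 ⊆ Csys I m β, L = ⋂₀ 𝒢}

/-- A family `𝒱 ⊆ 𝒫(X)` is upward closed w.r.t. inclusion. -/
def UpwardClosed {X : Type*} (𝒱 : Finset (Finset X)) : Prop :=
  ∀ Y ∈ 𝒱, ∀ Z : Finset X, Y ⊆ Z → Z ∈ 𝒱

/-- The upward restricted order `m₁ ≤_↑ m₂`. -/
def UpOrder {X : Type*} [Fintype X] (m₁ m₂ : Finset X → ℝ) : Prop :=
  ∀ 𝒱 : Finset (Finset X), UpwardClosed 𝒱 →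
    ∑ Y ∈ 𝒱, m₁ Y ≤ ∑ Y ∈ 𝒱, m₂ Y

/-- `S` is a specialization matrix witnessing `m₁ ≤_s m₂`. -/
def IsSpecMatrix {X : Type*} [Fintype X] (S : Finset X → Finset X → ℝ)
    (m₁ m₂ : Finset X → ℝ) : Prop :=
  (∀ W Y : Finset X, 0 ≤ S W Y ∧ S W Y ≤ 1) ∧
  (∀ Y : Finset X, ∑ W : Finset X, S W Y = 1) ∧
  (∀ W Y : Finset X, 0 < S W Y → W ⊆ Y) ∧
  (∀ W : Finset X, m₁ W = ∑ Y : Finset X, S W Y * m₂ Y)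

/-- The specialization order `m₁ ≤_s m₂`. -/
def SpecOrder {X : Type*} [Fintype X] (m₁ m₂ : Finset X → ℝ) : Prop :=
  ∃ S : Finset X → Finset X → ℝ, IsSpecMatrix S m₁ m₂

/-- The quality function `q_m(Y) = Σ_{Y ⊆ Z} m(Z)`. -/
def quality {X : Type*} [Fintype X] (m : Finset X → ℝ) (Y : Finset X) : ℝ :=
  ∑ Z : Finset X, if Y ⊆ Z then m Z else 0

/-- The plausibility function `pl_m(Y) = Σ_{Z ∩ Y ≠ ∅} m(Z)`. -/
def plausibility {X : Type*} [Fintype X] (m : Finset X → ℝ) (Y : Finset X) : ℝ :=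
  ∑ Z : Finset X, if (Z ∩ Y).Nonempty then m Z else 0

/-- The unnormalized Dempster combination `(m₁ ∩_m m₂)(Y) = Σ_{Z₁ ∩ Z₂ = Y} m₁(Z₁)·m₂(Z₂)`. -/
def interComb {X : Type*} [Fintype X] (m₁ m₂ : Finset X → ℝ) (Y : Finset X) : ℝ :=
  ∑ Z : Finset X × Finset X, if Z.1 ∩ Z.2 = Y then m₁ Z.1 * m₂ Z.2 else 0

/-- The disjunctive combination `(m₁ ∪_m m₂)(Y) = Σ_{Z₁ ∪ Z₂ = Y} m₁(Z₁)·m₂(Z₂)`. -/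
def unionComb {X : Type*} [Fintype X] (m₁ m₂ : Finset X → ℝ) (Y : Finset X) : ℝ :=
  ∑ Z : Finset X × Finset X, if Z.1 ∪ Z.2 = Y then m₁ Z.1 * m₂ Z.2 else 0

/-- The combined agenda `(◇c)(Y) = Σ_{(Z_j) : ⋂_j Z_j = Y} Π_j m_j(Z_j)`,
for a finite nonempty index set of agents `ι`. -/
def diamondAgenda {ι X : Type*} [Fintype ι] [Fintype X] (m : ι → Finset X → ℝ)
    (Y : Finset X) : ℝ :=
  ∑ Z : ι → Finset X,
    if (⋂ j, (Z j : Set X)) = (Y : Set X) then ∏ j, m j (Z j) else 0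

/-- The distributed agenda `(▷c)(Y) = Σ_{(Z_j) : ⋃_j Z_j = Y} Π_j m_j(Z_j)`,
for a finite nonempty index set of agents `ι`. -/
def triangleAgenda {ι X : Type*} [Fintype ι] [Fintype X] (m : ι → Finset X → ℝ)
    (Y : Finset X) : ℝ :=
  ∑ Z : ι → Finset X,
    if (⋃ j, (Z j : Set X)) = (Y : Set X) then ∏ j, m j (Z j) else 0

end
theorem IsExtent.mono {A X : Type*} {I : Set (A × X)} {Y Z : Set X} {B : Set A}
    (hB : IsExtent I Y B) (hYZ : Y ⊆ Z) : IsExtent I Z B := by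
  obtain ⟨Y', hY', rfl⟩ := hB
  exact ⟨Y', hY'.trans hYZ, rfl⟩

theorem upwardClosed_filter_isExtent {A X : Type*} [Fintype X] (I : Set (A × X)) (G : Set A) :
    UpwardClosed (Finset.univ.filter fun Y : Finset X => IsExtent I (Y : Set X) G) := by
  intro Y hY Z hYZ
  simp only [Finset.mem_filter, Finset.mem_univ, true_and] at hY ⊢
  exact hY.mono (Finset.coe_subset.mpr hYZ)

theorem stabilityIndex_mono_of_upOrder {X : Type*} [Fintype X]
    (m₁ m₂ : Finset X → ℝ) (hm₁ : IsMass m₁) (hm₂ : IsMass m₂)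
    (h : UpOrder m₁ m₂) {A : Type*} (I : Set (A × X)) (G : Set A) :
    stabilityIndex I m₁ G ≤ stabilityIndex I m₂ G := by
  simpa only [stabilityIndex, Finset.sum_filter] using
    h _ (upwardClosed_filter_isExtent I G)
end

section
/- Let (A, X, I) be a formal context with X finite and let m₁, m₂ be mass functions on X with m₁ ≤_↑ m₂. Then for every β ∈ [0,1], 𝒞(m₁, β) ⊆ 𝒞(m₂, β). -/
open scoped Classical

theorem stabilityIndex_eq_sum_filter {A X : Type*} [Fintype X] (I : Set (A × X))
    (m : Finset X → ℝ) (G : Set A) :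
    stabilityIndex I m G =
      ∑ Y ∈ Finset.univ.filter (fun Y : Finset X => IsExtent I (Y : Set X) G), m Y :=
  (Finset.sum_filter _ _).symm

/-- The stability index is monotone in the mass function for the upward restricted order. -/
theorem stabilityIndex_le_of_upOrder {A X : Type*} [Fintype X] (I : Set (A × X))
    {m₁ m₂ : Finset X → ℝ} (h : UpOrder m₁ m₂) (G : Set A) :
    stabilityIndex I m₁ G ≤ stabilityIndex I m₂ G := by
  rw [stabilityIndex_eq_sum_filter, stabilityIndex_eq_sum_filter]
  refine h _ fun Y hY Z hYZ => ?_
  rw [Finset.mem_filter] at hY ⊢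
  exact ⟨Finset.mem_univ Z, hY.2.mono (Finset.coe_subset.mpr hYZ)⟩

theorem Csys_mono_of_upOrder {A X : Type*} [Fintype X] (I : Set (A × X))
    (m₁ m₂ : Finset X → ℝ) (hm₁ : IsMass m₁) (hm₂ : IsMass m₂)
    (h : UpOrder m₁ m₂) (β : ℝ) (h0 : 0 ≤ β) (h1 : β ≤ 1) :
    Csys I m₁ β ⊆ Csys I m₂ β := by
  exact fun G hG => ⟨hG.1, hG.2.trans (stabilityIndex_le_of_upOrder I h G)⟩
end

section
/- Let X be a finite set and let m₁, m₂ be mass functions on X. If m₁ is a specialization of m₂ (m₁ ≤_s m₂), i.e. there exists a matrix S : 𝒫(X) × 𝒫(X) → [0,1] such that (a) Σ_{W ⊆ X} S(W, Y) = 1 for every Y ⊆ X, (b) S(W, Y) > 0 implies W ⊆ Y, and (c) m₁(W) = Σ_{Y ⊆ X} S(W, Y)·m₂(Y) for every W ⊆ X, then m₁ ≤_↑ m₂ in the upward restricted order. -/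
open scoped Classical

theorem upOrder_of_specOrder {X : Type*} [Fintype X] (m₁ m₂ : Finset X → ℝ)
    (hm₁ : IsMass m₁) (hm₂ : IsMass m₂) (h : SpecOrder m₁ m₂) :
    UpOrder m₁ m₂ := by
  obtain ⟨S, hS01, hSsum, hSsub, hSm⟩ := h
  intro 𝒱 h𝒱
  calc ∑ W ∈ 𝒱, m₁ W = ∑ Y : Finset X, (∑ W ∈ 𝒱, S W Y) * m₂ Y := by
        simp only [hSm, Finset.sum_mul]
        exact Finset.sum_comm
    _ = ∑ Y ∈ 𝒱, (∑ W ∈ 𝒱, S W Y) * m₂ Y := by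
        refine (Finset.sum_subset (Finset.subset_univ 𝒱) fun Y _ hY => ?_).symm
        rw [Finset.sum_eq_zero, zero_mul]
        intro W hW
        by_contra hne
        exact hY (h𝒱 W hW Y (hSsub W Y ((hS01 W Y).1.lt_of_ne' hne)))
    _ ≤ ∑ Y ∈ 𝒱, m₂ Y := by
        refine Finset.sum_le_sum fun Y _ => mul_le_of_le_one_left (hm₂.1 Y).1 ?_
        rw [← hSsum Y]
        exact Finset.sum_le_sum_of_subset_of_nonneg (Finset.subset_univ 𝒱)
          fun W _ _ => (hS01 W Y).1
end

section
/- Let X be a finite set and let m₁, m₂ be mass functions on X. If m₁ ≤_↑ m₂ in the upward restricted order, then m₁ ≤_pl m₂, i.e. pl_{m₁}(Y) ≤ pl_{m₂}(Y) for every Y ⊆ X, where pl_m(Y) := Σ_{Z ⊆ X, Z ∩ Y ≠ ∅} m(Z). -/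
open scoped Classical

theorem plausibility_le_of_upOrder {X : Type*} [Fintype X] (m₁ m₂ : Finset X → ℝ)
    (hm₁ : IsMass m₁) (hm₂ : IsMass m₂) (h : UpOrder m₁ m₂) :
    ∀ Y : Finset X, plausibility m₁ Y ≤ plausibility m₂ Y := by
  intro Y
  simp only [plausibility, ← Finset.sum_filter]
  refine h _ fun Z hZ W hZW => ?_
  rw [Finset.mem_filter] at hZ ⊢
  exact ⟨Finset.mem_univ W, hZ.2.mono (Finset.inter_subset_inter_right hZW)⟩
end

section
/- There exist a finite set X with three elements and mass functions m₁, m₂ on X such that m₁ ≤_q m₂ (q_{m₁}(Y) ≤ q_{m₂}(Y) for every Y ⊆ X) but m₁ ≤_↑ m₂ fails; i.e., there is an upward-closed family 𝒱 ⊆ 𝒫(X) with Σ_{Y ∈ 𝒱} m₂(Y) < Σ_{Y ∈ 𝒱} m₁(Y). (For X = {y₁, y₂, y₃}, take m₁({y₁,y₃}) = 0.3, m₁({y₂,y₃}) = 0.3, m₁({y₁,y₂,y₃}) = 0.2, m₁({y₃}) = 0.2; m₂({y₁,y₃}) = 0.1, m₂({y₂,y₃}) = 0.1, m₂({y₁,y₂,y₃})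 = 0.5, m₂({y₃}) = 0.3; and 𝒱 = {{y₁,y₃}, {y₂,y₃}, {y₁,y₂,y₃}}.) -/
open scoped Classical

/-- The function on `𝒫({0, 1, 2})` with values `a`, `b`, `c`, `d` at `{0, 2}`, `{1, 2}`,
`{0, 1, 2}`, `{2}`, and zero elsewhere. -/
def fourPoint (a b c d : ℝ) (Y : Finset (Fin 3)) : ℝ :=
  (if Y = {0, 2} then a else 0) + (if Y = {1, 2} then b else 0) +
    (if Y = Finset.univ then c else 0) + (if Y = {2} then d else 0)

theorem sum_fourPoint (a b c d : ℝ) (𝒱 : Finset (Finset (Fin 3))) :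
    ∑ Y ∈ 𝒱, fourPoint a b c d Y =
      (if {0, 2} ∈ 𝒱 then a else 0) + (if {1, 2} ∈ 𝒱 then b else 0) +
        (if Finset.univ ∈ 𝒱 then c else 0) + (if {2} ∈ 𝒱 then d else 0) := by
  simp only [fourPoint, Finset.sum_add_distrib, Finset.sum_ite_eq']

theorem quality_fourPoint (a b c d : ℝ) (Y : Finset (Fin 3)) :
    quality (fourPoint a b c d) Y =
      (if Y ⊆ {0, 2} then a else 0) + (if Y ⊆ {1, 2} then b else 0) + c +
        (if Y ⊆ {2} then d else 0) := by
  have h : quality (fourPoint a b c d) Y =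
      ∑ Z ∈ Finset.univ.filter (Y ⊆ ·), fourPoint a b c d Z := by
    rw [quality, Finset.sum_filter]
    congr!
  rw [h, sum_fourPoint]
  simp only [Finset.mem_filter, Finset.mem_univ, true_and, Finset.subset_univ, if_true]

theorem isMass_fourPoint {a b c d : ℝ} (ha : 0 ≤ a) (hb : 0 ≤ b) (hc : 0 ≤ c) (hd : 0 ≤ d)
    (h : a + b + c + d = 1) : IsMass (fourPoint a b c d) := by
  refine ⟨fun Y => ?_, by simpa [sum_fourPoint] using h⟩
  unfold fourPoint
  constructor
  · positivity
  · split_ifs <;> linarith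

theorem qOrder_not_upOrder :
    ∃ (X : Type) (inst : Fintype X), @Fintype.card X inst = 3 ∧
      ∃ m₁ m₂ : Finset X → ℝ,
        @IsMass X inst m₁ ∧ @IsMass X inst m₂ ∧
        (∀ Y : Finset X, @quality X inst m₁ Y ≤ @quality X inst m₂ Y) ∧
        ∃ 𝒱 : Finset (Finset X), UpwardClosed 𝒱 ∧
          ∑ Y ∈ 𝒱, m₂ Y < ∑ Y ∈ 𝒱, m₁ Y := by
  refine ⟨Fin 3, inferInstance, by simp, fourPoint 0.3 0.3 0.2 0.2, fourPoint 0.1 0.1 0.5 0.3,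
    isMass_fourPoint (by norm_num) (by norm_num) (by norm_num) (by norm_num) (by norm_num),
    isMass_fourPoint (by norm_num) (by norm_num) (by norm_num) (by norm_num) (by norm_num),
    fun Y => ?_, Finset.univ.filter (fun Y => {0, 2} ⊆ Y ∨ {1, 2} ⊆ Y), ?_, ?_⟩
  · have hinter : Y ⊆ {0, 2} → Y ⊆ {1, 2} → Y ⊆ {2} := by
      intro h₀ h₁ x hx
      have h₀ := h₀ hx
      have h₁ := h₁ hx
      revert h₀ h₁
      fin_cases x <;> simp
    rw [quality_fourPoint, quality_fourPoint]
    by_cases h₀ : Y ⊆ {0, 2} <;> by_cases h₁ : Y ⊆ {1, 2} <;> by_cases h₂ : Y ⊆ {2} <;>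
      first
        | exact absurd (hinter h₀ h₁) h₂
        | (simp only [h₀, h₁, h₂, if_true, if_false]; norm_num)
  · intro Y hY Z hYZ
    simp only [Finset.mem_filter, Finset.mem_univ, true_and] at hY ⊢
    exact hY.imp (fun h => h.trans hYZ) (fun h => h.trans hYZ)
  · rw [sum_fourPoint, sum_fourPoint]
    simp [Finset.insert_subset_iff]
    norm_num
end

section
/- There exist a finite set X with three elements and mass functions m₃, m₄ on X such that m₄ ≤_pl m₃ (pl_{m₄}(Y) ≤ pl_{m₃}(Y) for every Y ⊆ X) but m₄ ≤_↑ m₃ fails; i.e., there is an upward-closed family 𝒱 ⊆ 𝒫(X) with Σ_{Y ∈ 𝒱} m₃(Y) < Σ_{Y ∈ 𝒱} m₄(Y). (For X = {y₁, y₂, y₃}, take m₃({y₁,y₂}) = 0.3, m₃({y₂,y₃}) = 0.4, m₃({y₁,y₃}) = 0.3; m₄({y₁}) = 0.1, m₄({y₂}) = 0.2, m₄({y₃}) = 0.2, m₄({y₁,y₂}) = 0.5; and 𝒱 = {{y₁,y₂}, {y₁,y₂,y₃}}.) -/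
open scoped Classical

theorem plausibility_add {X : Type*} [Fintype X] (m₁ m₂ : Finset X → ℝ) (Y : Finset X) :
    plausibility (m₁ + m₂) Y = plausibility m₁ Y + plausibility m₂ Y := by
  simp only [plausibility, ← Finset.sum_add_distrib, Pi.add_apply]
  refine Finset.sum_congr rfl fun Z _ => ?_
  split_ifs <;> simp

theorem plausibility_single {X : Type*} [Fintype X] [DecidableEq (Finset X)]
    (A : Finset X) (r : ℝ) (Y : Finset X) :
    plausibility (Pi.single A r) Y = if ∃ x ∈ A, x ∈ Y then r else 0 := by
  rw [plausibility, Finset.sum_eq_single A]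
  · simp [Finset.Nonempty]
  · intro Z _ hZ
    simp [Pi.single_eq_of_ne hZ]
  · simp

theorem isMass_of_nonneg {X : Type*} [Fintype X] {m : Finset X → ℝ} (h₀ : 0 ≤ m)
    (h₁ : ∑ Y, m Y = 1) : IsMass m :=
  ⟨fun Y => ⟨h₀ Y, h₁ ▸ Finset.single_le_sum (fun Z _ => h₀ Z) (Finset.mem_univ Y)⟩, h₁⟩

theorem plOrder_not_upOrder :
    ∃ (X : Type) (inst : Fintype X), @Fintype.card X inst = 3 ∧
      ∃ m₃ m₄ : Finset X → ℝ,
        @IsMass X inst m₃ ∧ @IsMass X inst m₄ ∧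
        (∀ Y : Finset X, @plausibility X inst m₄ Y ≤ @plausibility X inst m₃ Y) ∧
        ∃ 𝒱 : Finset (Finset X), UpwardClosed 𝒱 ∧
          ∑ Y ∈ 𝒱, m₃ Y < ∑ Y ∈ 𝒱, m₄ Y := by
  refine ⟨Fin 3, inferInstance, by simp,
    Pi.single {0, 1} 0.3 + Pi.single {1, 2} 0.4 + Pi.single {0, 2} 0.3,
    Pi.single {0} 0.1 + Pi.single {1} 0.2 + Pi.single {2} 0.2 + Pi.single {0, 1} 0.5,
    isMass_of_nonneg ?_ ?_, isMass_of_nonneg ?_ ?_, fun Y => ?_,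
    Finset.univ.filter fun Z => 0 ∈ Z ∧ 1 ∈ Z, ?_, ?_⟩
  · refine add_nonneg (add_nonneg ?_ ?_) ?_ <;>
      exact Pi.single_nonneg.2 (by norm_num)
  · simp only [Pi.add_apply, Finset.sum_add_distrib, Finset.sum_pi_single', Finset.mem_univ,
      if_true]
    norm_num
  · refine add_nonneg (add_nonneg (add_nonneg ?_ ?_) ?_) ?_ <;>
      exact Pi.single_nonneg.2 (by norm_num)
  · simp only [Pi.add_apply, Finset.sum_add_distrib, Finset.sum_pi_single', Finset.mem_univ,
      if_true]
    norm_num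
  · simp only [plausibility_add, plausibility_single, Finset.mem_insert, Finset.mem_singleton,
      exists_eq_or_imp, exists_eq_left]
    by_cases h0 : 0 ∈ Y <;> by_cases h1 : 1 ∈ Y <;> by_cases h2 : 2 ∈ Y <;>
      simp only [h0, h1, h2] <;> norm_num
  · intro Y hY Z hYZ
    simp only [Finset.mem_filter, Finset.mem_univ, true_and] at hY ⊢
    exact ⟨hYZ hY.1, hYZ hY.2⟩
  · simp only [Pi.add_apply, Finset.sum_add_distrib, Finset.sum_pi_single', Finset.mem_filter,
      Finset.mem_univ, true_and]
    norm_num [Fin.ext_iff]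
end

section
/- Let X be a finite set and let m₁, m₂ be mass functions on X. Then the unnormalized Dempster combination m₁ ∩_m m₂, defined by (m₁ ∩_m m₂)(Y) := Σ_{Z₁ ∩ Z₂ = Y} m₁(Z₁)·m₂(Z₂), satisfies m₁ ∩_m m₂ ≤_s m₁; a witnessing specialization matrix is S(W, Y) := Σ_{Y' ⊆ X, Y' ∩ Y = W} m₂(Y'). -/
open scoped Classical

theorem isSpecMatrix_interComb {X : Type*} [Fintype X] (m₁ : Finset X → ℝ) {m₂ : Finset X → ℝ}
    (hm₂ : IsMass m₂) :
    IsSpecMatrix (fun W Y => ∑ Y' : Finset X, if Y' ∩ Y = W then m₂ Y' else 0)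
      (interComb m₁ m₂) m₁ := by
  obtain ⟨hbound, hsum⟩ := hm₂
  refine ⟨fun W Y => ⟨?_, ?_⟩, fun Y => ?_, fun W Y hpos => ?_, fun W => ?_⟩
  · exact Finset.sum_nonneg fun Z _ => by
      split_ifs
      exacts [(hbound Z).1, le_rfl]
  · rw [← hsum]
    exact Finset.sum_le_sum fun Z _ => by
      split_ifs
      exacts [le_rfl, (hbound Z).1]
  · rw [Finset.sum_comm]
    simpa using hsum
  · obtain ⟨Z, -, hZ⟩ := Finset.exists_ne_zero_of_sum_ne_zero hpos.ne'
    have hW : Z ∩ Y = W := by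
      by_contra h
      exact hZ (if_neg h)
    exact hW ▸ Finset.inter_subset_right
  · simp only [interComb, Fintype.sum_prod_type, Finset.sum_mul]
    refine Finset.sum_congr rfl fun Y _ => Finset.sum_congr rfl fun Z _ => ?_
    rw [Finset.inter_comm, ite_mul, zero_mul, mul_comm]

theorem interComb_specOrder {X : Type*} [Fintype X] (m₁ m₂ : Finset X → ℝ)
    (hm₁ : IsMass m₁) (hm₂ : IsMass m₂) :
    IsSpecMatrix (fun W Y => ∑ Y' : Finset X, if Y' ∩ Y = W then m₂ Y' else 0)
      (interComb m₁ m₂) m₁ ∧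
    SpecOrder (interComb m₁ m₂) m₁ := by
  exact ⟨isSpecMatrix_interComb m₁ hm₂, _, isSpecMatrix_interComb m₁ hm₂⟩
end

section
/- Let X be a finite set and let m₁, m₂ be mass functions on X. Then m₁ ≤_↑ m₁ ∪_m m₂ in the upward restricted order, where (m₁ ∪_m m₂)(Y) := Σ_{Z₁ ∪ Z₂ = Y} m₁(Z₁)·m₂(Z₂). -/
open scoped Classical

/-- The mass given by `unionComb m₁ m₂` to a family `𝒱` is the total weight of the pairs whose
union lies in `𝒱`. -/
theorem sum_unionComb {X : Type*} [Fintype X] (m₁ m₂ : Finset X → ℝ) (𝒱 : Finset (Finset X)) :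
    ∑ Y ∈ 𝒱, unionComb m₁ m₂ Y =
      ∑ Z : Finset X × Finset X, if Z.1 ∪ Z.2 ∈ 𝒱 then m₁ Z.1 * m₂ Z.2 else 0 := by
  unfold unionComb
  rw [Finset.sum_comm]
  simp only [Finset.sum_ite_eq]

/-- If `m₂` has total mass `1`, the mass given by `m₁` to a family `𝒱` is the total weight of the
pairs whose first component lies in `𝒱`. -/
theorem sum_eq_sum_prod_ite {X : Type*} [Fintype X] (m₁ m₂ : Finset X → ℝ)
    (hm₂ : ∑ Y : Finset X, m₂ Y = 1) (𝒱 : Finset (Finset X)) :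
    ∑ Y ∈ 𝒱, m₁ Y =
      ∑ Z : Finset X × Finset X, if Z.1 ∈ 𝒱 then m₁ Z.1 * m₂ Z.2 else 0 := by
  simp only [Fintype.sum_prod_type, ← ite_zero_mul, ← Finset.mul_sum, hm₂, mul_one,
    Finset.sum_ite_mem, Finset.univ_inter]

theorem upOrder_unionComb {X : Type*} [Fintype X] (m₁ m₂ : Finset X → ℝ)
    (hm₁ : IsMass m₁) (hm₂ : IsMass m₂) :
    UpOrder m₁ (unionComb m₁ m₂) := by
  intro 𝒱 h𝒱
  rw [sum_unionComb, sum_eq_sum_prod_ite m₁ m₂ hm₂.2]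
  refine Finset.sum_le_sum fun Z _ => ?_
  have hZ : 0 ≤ m₁ Z.1 * m₂ Z.2 := mul_nonneg (hm₁.1 Z.1).1 (hm₂.1 Z.2).1
  by_cases h : Z.1 ∈ 𝒱
  · rw [if_pos h, if_pos (h𝒱 _ h _ Finset.subset_union_left)]
  · rw [if_neg h]
    split_ifs <;> simp [hZ]
end

section
/- Let X be a finite set, let c be a finite nonempty index set of agents, and for each j ∈ c let m_j be a mass function on X. Define the mass function ◇c by (◇c)(Y) := Σ over all families (Z_j)_{j ∈ c} of subsets of X with ⋂_{j ∈ c} Z_j = Y of Π_{j ∈ c} m_j(Z_j). Then for every j ∈ c, ◇c ≤_s m_j (◇c is a specialization of m_j). -/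
open scoped Classical

theorem sum_diamondAgenda {ι X : Type*} [Fintype ι] [Fintype X] (m : ι → Finset X → ℝ) :
    ∑ Y, diamondAgenda m Y = ∏ j, ∑ Y, m j Y := by
  simp only [diamondAgenda]
  rw [Finset.sum_comm, Finset.prod_univ_sum, Fintype.piFinset_univ]
  refine Finset.sum_congr rfl fun Z _ => ?_
  rw [Finset.sum_eq_single (⋂ j, (Z j : Set X)).toFinset]
  · simp
  · intro Y _ hY
    refine if_neg fun h => hY ?_
    simp [h]
  · simp

theorem diamondAgenda_nonneg {ι X : Type*} [Fintype ι] [Fintype X] {m : ι → Finset X → ℝ}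
    (hm : ∀ j Y, 0 ≤ m j Y) (Y : Finset X) : 0 ≤ diamondAgenda m Y := by
  refine Finset.sum_nonneg fun Z _ => ?_
  split_ifs
  · exact Finset.prod_nonneg fun j _ => hm j (Z j)
  · exact le_rfl

theorem IsMass.of_nonneg {X : Type*} [Fintype X] {m : Finset X → ℝ} (h0 : ∀ Y, 0 ≤ m Y)
    (h1 : ∑ Y, m Y = 1) : IsMass m :=
  ⟨fun Y => ⟨h0 Y, h1 ▸ Finset.single_le_sum (fun Z _ => h0 Z) (Finset.mem_univ Y)⟩, h1⟩

theorem IsMass.diamondAgenda {ι X : Type*} [Fintype ι] [Fintype X] {m : ι → Finset X → ℝ}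
    (hm : ∀ j, IsMass (m j)) : IsMass (diamondAgenda m) :=
  .of_nonneg (diamondAgenda_nonneg fun j Y => ((hm j).1 Y).1) <| by
    simp [sum_diamondAgenda, (hm _).2]

theorem isMass_single {X : Type*} [Fintype X] (Y : Finset X) :
    IsMass (Pi.single Y (1 : ℝ)) :=
  .of_nonneg (fun Z => by rw [Pi.single_apply]; split_ifs <;> simp) (by simp)

/-- If agent `j` is certain of `Y`, the combined agenda only charges subsets of `Y`. -/
theorem diamondAgenda_update_single_eq_zero {ι X : Type*} [Fintype ι] [Fintype X]
    (m : ι → Finset X → ℝ) (j : ι) {W Y : Finset X} (h : ¬W ⊆ Y) :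
    diamondAgenda (Function.update m j (Pi.single Y 1)) W = 0 := by
  refine Finset.sum_eq_zero fun Z _ => ?_
  split_ifs with hZ
  · have hj : Z j ≠ Y := by
      rintro rfl
      exact h (Finset.coe_subset.1 (hZ ▸ Set.iInter_subset _ j))
    exact Finset.prod_eq_zero (Finset.mem_univ j) (by simp [hj])
  · rfl

/-- The combined agenda is the mixture, over the sets `Y` weighted by `m j`, of the combined
agendas in which agent `j` is certain of `Y`. -/
theorem diamondAgenda_eq_sum_update_single {ι X : Type*} [Fintype ι] [Fintype X]
    (m : ι → Finset X → ℝ) (j : ι) (W : Finset X) :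
    diamondAgenda m W =
      ∑ Y, diamondAgenda (Function.update m j (Pi.single Y 1)) W * m j Y := by
  simp only [diamondAgenda, Finset.sum_mul]
  rw [Finset.sum_comm]
  refine Finset.sum_congr rfl fun Z _ => ?_
  split_ifs with hZ
  · have key (Y : Finset X) :
        ∏ i, Function.update m j (Pi.single Y 1) i (Z i) =
          (Pi.single Y (1 : ℝ) : Finset X → ℝ) (Z j) * ∏ i ∈ Finset.univ.erase j, m i (Z i) := by
      rw [← Finset.mul_prod_erase _ _ (Finset.mem_univ j), Function.update_self]
      congr 1
      refine Finset.prod_congr rfl fun i hi => ?_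
      rw [Function.update_of_ne (Finset.ne_of_mem_erase hi)]
    simp only [key, Pi.single_apply]
    rw [← Finset.mul_prod_erase _ _ (Finset.mem_univ j)]
    simp [mul_comm]
  · simp

theorem diamondAgenda_specOrder {ι X : Type*} [Fintype ι] [Nonempty ι] [Fintype X]
    (m : ι → Finset X → ℝ) (hm : ∀ j, IsMass (m j)) (j : ι) :
    SpecOrder (diamondAgenda m) (m j) := by
  have hS (Y : Finset X) :
      IsMass (diamondAgenda (Function.update m j (Pi.single Y 1))) := by
    refine IsMass.diamondAgenda fun i => ?_
    obtain rfl | hi := eq_or_ne i j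
    · simpa using isMass_single Y
    · simpa [hi] using hm i
  refine ⟨fun W Y => diamondAgenda (Function.update m j (Pi.single Y 1)) W,
    fun W Y => (hS Y).1 W, fun Y => (hS Y).2, fun W Y h => ?_,
    diamondAgenda_eq_sum_update_single m j⟩
  by_contra hWY
  exact h.ne' (diamondAgenda_update_single_eq_zero m j hWY)
end

section
/- Let X be a finite set, let c be a finite nonempty index set of agents, and for each j ∈ c let m_j be a mass function on X. Define the mass function ▷c by (▷c)(Y) := Σ over all families (Z_j)_{j ∈ c} of subsets of X with ⋃_{j ∈ c} Z_j = Y of Π_{j ∈ c} m_j(Z_j). Then for every j ∈ c, m_j ≤_↑ ▷c in the upward restricted order. -/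
open scoped Classical

/-- Summing a product of mass functions over all families whose `j`-th member lies in `𝒱`
gives the `m j`-mass of `𝒱`. -/
theorem sum_prod_mass_marginal {ι X : Type*} [Fintype ι] [Fintype X]
    {m : ι → Finset X → ℝ} (hm : ∀ i, IsMass (m i)) (j : ι) (𝒱 : Finset (Finset X)) :
    ∑ Z : ι → Finset X with Z j ∈ 𝒱, ∏ i, m i (Z i) = ∑ Y ∈ 𝒱, m j Y := by
  have hfilter : Finset.univ.filter (fun Z : ι → Finset X => Z j ∈ 𝒱) =
      Fintype.piFinset (Function.update (fun _ => Finset.univ) j 𝒱) := by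
    ext Z
    simp only [Finset.mem_filter, Finset.mem_univ, true_and, Fintype.mem_piFinset]
    refine ⟨fun h i => ?_, fun h => by simpa using h j⟩
    obtain rfl | hi := eq_or_ne i j <;> simp [*]
  rw [hfilter, ← Finset.prod_univ_sum, Fintype.prod_eq_single j]
  · simp
  · intro i hi
    simpa [hi] using (hm i).2

/-- The distributed agenda mass of `𝒱` is the total product mass of the families whose union
lies in `𝒱`. -/
theorem sum_triangleAgenda {ι X : Type*} [Fintype ι] [Fintype X]
    (m : ι → Finset X → ℝ) (𝒱 : Finset (Finset X)) :
    ∑ Y ∈ 𝒱, triangleAgenda m Y =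
      ∑ Z : ι → Finset X with Finset.univ.biUnion Z ∈ 𝒱, ∏ i, m i (Z i) := by
  have hunion (Z : ι → Finset X) (Y : Finset X) :
      (⋃ j, (Z j : Set X)) = (Y : Set X) ↔ Finset.univ.biUnion Z = Y := by
    rw [← Finset.coe_inj]
    simp
  simp only [triangleAgenda, hunion]
  rw [Finset.sum_comm, Finset.sum_filter]
  simp only [Finset.sum_ite_eq]

theorem triangleAgenda_upOrder {ι X : Type*} [Fintype ι] [Nonempty ι] [Fintype X]
    (m : ι → Finset X → ℝ) (hm : ∀ j, IsMass (m j)) (j : ι) :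
    UpOrder (m j) (triangleAgenda m) := by
  intro 𝒱 h𝒱
  rw [← sum_prod_mass_marginal hm j 𝒱, sum_triangleAgenda]
  refine Finset.sum_le_sum_of_subset_of_nonneg ?_
    fun Z _ _ => Finset.prod_nonneg fun i _ => ((hm i).1 (Z i)).1
  exact Finset.monotone_filter_right _ fun Z _ hZ =>
    h𝒱 _ hZ _ (Finset.subset_biUnion_of_mem Z (Finset.mem_univ j))
end

section
/- Let X be a finite set. The upward restricted order ≤_↑ on mass functions on X is a partial order; in particular it is antisymmetric: if m₁ ≤_↑ m₂ and m₂ ≤_↑ m₁, then m₁(Y) = m₂(Y) for every Y ⊆ X. -/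
open scoped Classical

theorem upwardClosed_filter_subset {X : Type*} [Fintype X] (Y : Finset X) :
    UpwardClosed (Finset.univ.filter fun Z : Finset X => Y ⊆ Z) := by
  intro Z hZ W hZW
  simp only [Finset.mem_filter, Finset.mem_univ, true_and] at hZ ⊢
  exact hZ.trans hZW

theorem upwardClosed_filter_ssubset {X : Type*} [Fintype X] (Y : Finset X) :
    UpwardClosed (Finset.univ.filter fun Z : Finset X => Y ⊂ Z) := by
  intro Z hZ W hZW
  simp only [Finset.mem_filter, Finset.mem_univ, true_and] at hZ ⊢
  exact hZ.trans_subset hZW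

theorem sum_filter_subset_eq_add {X : Type*} [Fintype X] (m : Finset X → ℝ) (Y : Finset X) :
    ∑ Z ∈ Finset.univ.filter (fun Z : Finset X => Y ⊆ Z), m Z =
      m Y + ∑ Z ∈ Finset.univ.filter (fun Z : Finset X => Y ⊂ Z), m Z := by
  rw [← Finset.sum_insert (by simp)]
  congr 1
  ext Z
  simp only [Finset.mem_insert, Finset.mem_filter, Finset.mem_univ, true_and]
  exact le_iff_eq_or_lt.trans (or_congr_left eq_comm)

theorem UpOrder.refl {X : Type*} [Fintype X] (m : Finset X → ℝ) : UpOrder m m :=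
  fun _ _ => le_rfl

theorem UpOrder.trans {X : Type*} [Fintype X] {m₁ m₂ m₃ : Finset X → ℝ}
    (h₁₂ : UpOrder m₁ m₂) (h₂₃ : UpOrder m₂ m₃) : UpOrder m₁ m₃ :=
  fun 𝒱 h𝒱 => (h₁₂ 𝒱 h𝒱).trans (h₂₃ 𝒱 h𝒱)

theorem UpOrder.antisymm {X : Type*} [Fintype X] {m₁ m₂ : Finset X → ℝ}
    (h₁₂ : UpOrder m₁ m₂) (h₂₁ : UpOrder m₂ m₁) (Y : Finset X) : m₁ Y = m₂ Y := by
  have hsub := (h₁₂ _ (upwardClosed_filter_subset Y)).antisymm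
    (h₂₁ _ (upwardClosed_filter_subset Y))
  have hssub := (h₁₂ _ (upwardClosed_filter_ssubset Y)).antisymm
    (h₂₁ _ (upwardClosed_filter_ssubset Y))
  rw [sum_filter_subset_eq_add, sum_filter_subset_eq_add, hssub] at hsub
  exact add_right_cancel hsub

theorem upOrder_partialOrder {X : Type*} [Fintype X] :
    (∀ m : Finset X → ℝ, IsMass m → UpOrder m m) ∧
    (∀ m₁ m₂ m₃ : Finset X → ℝ, IsMass m₁ → IsMass m₂ → IsMass m₃ →
      UpOrder m₁ m₂ → UpOrder m₂ m₃ → UpOrder m₁ m₃) ∧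
    (∀ m₁ m₂ : Finset X → ℝ, IsMass m₁ → IsMass m₂ →
      UpOrder m₁ m₂ → UpOrder m₂ m₁ → ∀ Y : Finset X, m₁ Y = m₂ Y) := by
  exact ⟨fun m _ => .refl m, fun _ _ _ _ _ _ h₁₂ h₂₃ => h₁₂.trans h₂₃,
    fun _ _ _ _ h₁₂ h₂₁ => h₁₂.antisymm h₂₁⟩
end
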